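/- Stability of the thermal channel in the input state: Assume the constraints are strictly feasible, and define s̃(φ) := max { S_φ(N) : N a feasible Choi matrix } for density matrices φ on ℂ^{d_R} (the maximum exists by compactness). Then: (i) the function φ ↦ s̃(φ) is continuous on the set of all density matrices on ℂ^{d_R}; (ii) for every positive definite density matrix φ there is a unique feasible Choi matrix T(φ) with S_φ(T(φ)) = s̃(φ), and the map φ ↦ T(φ) is continuous on the set of positive definite density matrices. -/

import Mathlib

/-! Statement 6: Stability of the thermal channel in the input state (Berge maximum theorem). -/

noncomputable section
open scoped Kronecker ComplexOrder
open Matrix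

namespace ThermalPaper

/-- Functional calculus for Hermitian matrices (junk value `0` on non-Hermitian input). -/
def hermCFC {n : Type*} [Fintype n] [DecidableEq n] (f : ℝ → ℝ)
    (A : Matrix n n ℂ) : Matrix n n ℂ :=
  if hA : A.IsHermitian then
    (hA.eigenvectorUnitary : Matrix n n ℂ) *
      Matrix.diagonal (fun i => (f (hA.eigenvalues i) : ℂ)) *
      star (hA.eigenvectorUnitary : Matrix n n ℂ)
  else 0

/-- Matrix logarithm of a Hermitian matrix, with the convention `log 0 = 0`. -/
def matLog {n : Type*} [Fintype n] [DecidableEq n] (A : Matrix n n ℂ) : Matrix n n ℂ :=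
  hermCFC Real.log A

/-- Positive semidefinite square root of a positive semidefinite matrix. -/
def matSqrt {n : Type*} [Fintype n] [DecidableEq n] (A : Matrix n n ℂ) : Matrix n n ℂ :=
  hermCFC Real.sqrt A

/-- `X^{-1/2}`: the PSD square root of the Moore–Penrose pseudoinverse of `X`. -/
def matPinvSqrt {n : Type*} [Fintype n] [DecidableEq n] (A : Matrix n n ℂ) : Matrix n n ℂ :=
  hermCFC (fun x => Real.sqrt x⁻¹) A

/-- `Π^X`: orthogonal projection onto the range (support) of a PSD matrix `X`. -/
def suppProj {n : Type*} [Fintype n] [DecidableEq n] (A : Matrix n n ℂ) : Matrix n n ℂ :=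
  hermCFC (fun x => if x = 0 then 0 else 1) A

/-- Von Neumann entropy `S(X) = −tr(X log X)`. -/
def vnEnt {n : Type*} [Fintype n] [DecidableEq n] (A : Matrix n n ℂ) : ℝ :=
  -(Matrix.trace (A * matLog A)).re

/-- A density matrix: positive semidefinite with unit trace. -/
def IsDensity {n : Type*} [Fintype n] [DecidableEq n] (ρ : Matrix n n ℂ) : Prop :=
  ρ.PosSemidef ∧ Matrix.trace ρ = 1

variable {dB dR : ℕ}

/-- Partial trace over the `B` factor. -/
def ptraceB (N : Matrix (Fin dB × Fin dR) (Fin dB × Fin dR) ℂ) :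
    Matrix (Fin dR) (Fin dR) ℂ :=
  Matrix.of fun r r' => ∑ b : Fin dB, N (b, r) (b, r')

/-- A Choi matrix: positive semidefinite with `tr_B N = 1`. -/
def IsChoi (N : Matrix (Fin dB × Fin dR) (Fin dB × Fin dR) ℂ) : Prop :=
  N.PosSemidef ∧ ptraceB N = 1

/-- Channel conditional entropy `S_ρ(N)` with respect to the input state `ρ`. -/
def condEnt (ρ : Matrix (Fin dR) (Fin dR) ℂ)
    (N : Matrix (Fin dB × Fin dR) (Fin dB × Fin dR) ℂ) : ℝ :=
  vnEnt (((1 : Matrix (Fin dB) (Fin dB) ℂ) ⊗ₖ matSqrt ρ) * N *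
    ((1 : Matrix (Fin dB) (Fin dB) ℂ) ⊗ₖ matSqrt ρ)) - vnEnt ρ

/-- Channel entropy: the infimum of `S_ρ(N)` over density matrices `ρ`. -/
def chanEnt (N : Matrix (Fin dB × Fin dR) (Fin dB × Fin dR) ℂ) : ℝ :=
  sInf {x : ℝ | ∃ ρ : Matrix (Fin dR) (Fin dR) ℂ, IsDensity ρ ∧ condEnt ρ N = x}

/-- `s̃(φ)`: the maximal channel conditional entropy compatible with the constraints. -/
def stilde {J : ℕ} (C : Fin J → Matrix (Fin dB × Fin dR) (Fin dB × Fin dR) ℂ)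
    (q : Fin J → ℝ) (φ : Matrix (Fin dR) (Fin dR) ℂ) : ℝ :=
  sSup {x : ℝ | ∃ N : Matrix (Fin dB × Fin dR) (Fin dB × Fin dR) ℂ,
    IsChoi N ∧ (∀ j, Matrix.trace (C j * N) = (q j : ℂ)) ∧ condEnt φ N = x}

section Helpers

lemma unit_ms {n : Type*} [Fintype n] [DecidableEq n] (U : Matrix.unitaryGroup n ℂ) :
    (U : Matrix n n ℂ) * star (U : Matrix n n ℂ) = 1 := Unitary.mul_star_self_of_mem U.2

section Cont
open scoped Matrix.Norms.L2Operator

lemma hermCFC_eq {n : Type*} [Fintype n] [DecidableEq n] (f : ℝ → ℝ)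
    {A : Matrix n n ℂ} (hA : A.IsHermitian) : hermCFC f A = cfc f A := by
  rw [hA.cfc_eq, hermCFC, dif_pos hA, Matrix.IsHermitian.cfc, Unitary.conjStarAlgAut_apply]
  rfl

lemma continuousOn_hermCFC {n : Type*} [Fintype n] [DecidableEq n] {f : ℝ → ℝ}
    (hf : Continuous f) :
    ContinuousOn (hermCFC (n := n) f) {A : Matrix n n ℂ | A.IsHermitian} := by
  have h : ContinuousOn (fun A : Matrix n n ℂ => cfc f A) {A : Matrix n n ℂ | A.IsHermitian} :=
    ContinuousOn.cfc_of_mem_nhdsSet (s := Set.univ) f Filter.univ_mem continuousOn_id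
      (fun x hx => hx) hf.continuousOn
  exact h.congr fun A hA => hermCFC_eq f hA

end Cont

lemma hermCFC_isHermitian {n : Type*} [Fintype n] [DecidableEq n] (f : ℝ → ℝ)
    (A : Matrix n n ℂ) : (hermCFC f A).IsHermitian := by
  by_cases hA : A.IsHermitian
  · rw [hermCFC_eq f hA]
    exact cfc_predicate f A
  · rw [hermCFC, dif_neg hA]
    exact Matrix.isHermitian_zero

lemma trace_hermCFC {n : Type*} [Fintype n] [DecidableEq n] (f : ℝ → ℝ)
    {A : Matrix n n ℂ} (hA : A.IsHermitian) :
    (hermCFC f A).trace = ∑ i, (f (hA.eigenvalues i) : ℂ) := by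
  rw [hermCFC, dif_pos hA, Matrix.trace_mul_comm, ← Matrix.mul_assoc,
    Unitary.coe_star_mul_self, Matrix.one_mul, Matrix.trace_diagonal]

lemma finite_cont {n : Type*} [Fintype n] [DecidableEq n] (f : ℝ → ℝ)
    {A : Matrix n n ℂ} (hA : A.IsHermitian) : ContinuousOn f (spectrum ℝ A) := by
  rw [hA.spectrum_real_eq_range_eigenvalues]
  exact (Set.finite_range _).continuousOn f

lemma vnEnt_eq_trace {n : Type*} [Fintype n] [DecidableEq n]
    {A : Matrix n n ℂ} (hA : A.IsHermitian) :
    vnEnt A = (hermCFC Real.negMulLog A).trace.re := by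
  have hid : A = cfc (fun x : ℝ => x) A := (cfc_id' ℝ A hA).symm
  have h : A * matLog A = - hermCFC Real.negMulLog A := by
    rw [matLog, hermCFC_eq _ hA, hermCFC_eq _ hA, Real.negMulLog_eq_neg, cfc_neg, neg_neg]
    conv_lhs => enter [1]; rw [hid]
    rw [← cfc_mul _ _ A (finite_cont _ hA) (finite_cont _ hA)]
  rw [vnEnt, h]
  simp

lemma vnEnt_eq_sum {n : Type*} [Fintype n] [DecidableEq n]
    {A : Matrix n n ℂ} (hA : A.IsHermitian) :
    vnEnt A = ∑ i, Real.negMulLog (hA.eigenvalues i) := by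
  rw [vnEnt_eq_trace hA, trace_hermCFC _ hA]
  simp

lemma continuousOn_vnEnt {n : Type*} [Fintype n] [DecidableEq n] :
    ContinuousOn (vnEnt (n := n)) {A : Matrix n n ℂ | A.IsHermitian} := by
  have h : ContinuousOn (fun A : Matrix n n ℂ => (hermCFC Real.negMulLog A).trace.re)
      {A : Matrix n n ℂ | A.IsHermitian} := by
    have h1 : Continuous (fun A : Matrix n n ℂ => A.trace.re) :=
      Complex.continuous_re.comp (continuous_id.matrix_trace)
    exact h1.comp_continuousOn (continuousOn_hermCFC Real.continuous_negMulLog)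
  exact h.congr fun A hA => vnEnt_eq_trace hA

lemma matSqrt_mul_self {n : Type*} [Fintype n] [DecidableEq n]
    {A : Matrix n n ℂ} (hA : A.PosSemidef) : matSqrt A * matSqrt A = A := by
  rw [matSqrt, hermCFC_eq _ hA.1, ← cfc_mul _ _ A (finite_cont _ hA.1) (finite_cont _ hA.1)]
  conv_rhs => rw [← cfc_id' ℝ A hA.1]
  refine cfc_congr fun x hx => ?_
  rw [hA.1.spectrum_real_eq_range_eigenvalues] at hx
  obtain ⟨i, rfl⟩ := hx
  exact Real.mul_self_sqrt (hA.eigenvalues_nonneg i)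

/-- conjugated matrix -/
lemma conj_isHermitian {dB dR : ℕ} (φ : Matrix (Fin dR) (Fin dR) ℂ)
    {N : Matrix (Fin dB × Fin dR) (Fin dB × Fin dR) ℂ} (hN : N.IsHermitian) :
    (((1 : Matrix (Fin dB) (Fin dB) ℂ) ⊗ₖ matSqrt φ) * N *
      ((1 : Matrix (Fin dB) (Fin dB) ℂ) ⊗ₖ matSqrt φ)).IsHermitian := by
  have hS : ((1 : Matrix (Fin dB) (Fin dB) ℂ) ⊗ₖ matSqrt φ)ᴴ =
      (1 : Matrix (Fin dB) (Fin dB) ℂ) ⊗ₖ matSqrt φ := by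
    rw [Matrix.conjTranspose_kronecker, Matrix.conjTranspose_one,
      matSqrt, (hermCFC_isHermitian Real.sqrt φ).eq]
  have := Matrix.isHermitian_conjTranspose_mul_mul
    ((1 : Matrix (Fin dB) (Fin dB) ℂ) ⊗ₖ matSqrt φ) hN
  rwa [hS] at this

lemma conj_posSemidef {dB dR : ℕ} (φ : Matrix (Fin dR) (Fin dR) ℂ)
    {N : Matrix (Fin dB × Fin dR) (Fin dB × Fin dR) ℂ} (hN : N.PosSemidef) :
    (((1 : Matrix (Fin dB) (Fin dB) ℂ) ⊗ₖ matSqrt φ) * N *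
      ((1 : Matrix (Fin dB) (Fin dB) ℂ) ⊗ₖ matSqrt φ)).PosSemidef := by
  have hS : ((1 : Matrix (Fin dB) (Fin dB) ℂ) ⊗ₖ matSqrt φ)ᴴ =
      (1 : Matrix (Fin dB) (Fin dB) ℂ) ⊗ₖ matSqrt φ := by
    rw [Matrix.conjTranspose_kronecker, Matrix.conjTranspose_one,
      matSqrt, (hermCFC_isHermitian Real.sqrt φ).eq]
  have := hN.conjTranspose_mul_mul_same ((1 : Matrix (Fin dB) (Fin dB) ℂ) ⊗ₖ matSqrt φ)
  rwa [hS] at this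

lemma continuousOn_condEnt {dB dR : ℕ} :
    ContinuousOn (fun p : Matrix (Fin dR) (Fin dR) ℂ ×
        Matrix (Fin dB × Fin dR) (Fin dB × Fin dR) ℂ => condEnt p.1 p.2)
      {p | p.1.IsHermitian ∧ p.2.IsHermitian} := by
  unfold condEnt
  refine ContinuousOn.sub ?_ ?_
  · have hsq : ContinuousOn (fun p : Matrix (Fin dR) (Fin dR) ℂ ×
        Matrix (Fin dB × Fin dR) (Fin dB × Fin dR) ℂ => matSqrt p.1)
        {p | p.1.IsHermitian ∧ p.2.IsHermitian} :=
      (continuousOn_hermCFC Real.continuous_sqrt).comp continuousOn_fst fun p hp => hp.1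
    have hk : ContinuousOn (fun p : Matrix (Fin dR) (Fin dR) ℂ ×
        Matrix (Fin dB × Fin dR) (Fin dB × Fin dR) ℂ =>
          (1 : Matrix (Fin dB) (Fin dB) ℂ) ⊗ₖ matSqrt p.1)
        {p | p.1.IsHermitian ∧ p.2.IsHermitian} := by
      have hc : Continuous (fun A : Matrix (Fin dR) (Fin dR) ℂ =>
          (1 : Matrix (Fin dB) (Fin dB) ℂ) ⊗ₖ A) := by
        refine continuous_matrix fun i j => ?_
        simp only [Matrix.kroneckerMap_apply]
        exact continuous_const.mul (continuous_id.matrix_elem _ _)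
      exact hc.comp_continuousOn hsq
    exact continuousOn_vnEnt.comp ((hk.mul continuousOn_snd).mul hk)
      fun p hp => conj_isHermitian p.1 hp.2
  · exact continuousOn_vnEnt.comp continuousOn_fst fun p hp => hp.1

lemma norm_apply_le_trace {n : Type*} [Fintype n] [DecidableEq n]
    {A : Matrix n n ℂ} (hA : A.PosSemidef) (i j : n) : ‖A i j‖ ≤ A.trace.re := by
  have h1 : hermCFC id A = A := by rw [hermCFC_eq _ hA.1]; exact cfc_id ℝ A hA.1
  have h2 : A.trace.re = ∑ k, hA.1.eigenvalues k := by
    conv_lhs => rw [← h1, trace_hermCFC id hA.1]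
    simp
  have h3 : A i j = ∑ k, (hA.1.eigenvectorUnitary : Matrix n n ℂ) i k * (hA.1.eigenvalues k : ℂ) *
      star ((hA.1.eigenvectorUnitary : Matrix n n ℂ) j k) := by
    conv_lhs => rw [← h1, hermCFC, dif_pos hA.1]
    rw [Matrix.mul_apply]
    simp [Matrix.mul_diagonal, Matrix.star_apply]
  rw [h2, h3]
  refine (norm_sum_le _ _).trans (Finset.sum_le_sum fun k _ => ?_)
  have hu := fun i => entry_norm_bound_of_unitary hA.1.eigenvectorUnitary.2 i k
  have hl := hA.eigenvalues_nonneg k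
  rw [norm_mul, norm_mul, norm_star, Complex.norm_real, Real.norm_of_nonneg hl]
  calc _ ≤ 1 * hA.1.eigenvalues k * 1 := by
        gcongr
        · exact hu i
        · exact hu j
    _ = _ := by ring

/-- the feasible set -/
def feas {dB dR J : ℕ} (C : Fin J → Matrix (Fin dB × Fin dR) (Fin dB × Fin dR) ℂ)
    (q : Fin J → ℝ) : Set (Matrix (Fin dB × Fin dR) (Fin dB × Fin dR) ℂ) :=
  {N | IsChoi N ∧ ∀ j, Matrix.trace (C j * N) = (q j : ℂ)}

lemma trace_of_choi {dB dR : ℕ} {N : Matrix (Fin dB × Fin dR) (Fin dB × Fin dR) ℂ}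
    (hN : IsChoi N) : N.trace = (dR : ℂ) := by
  have h : N.trace = (ptraceB N).trace := by
    simp only [Matrix.trace, Matrix.diag, ptraceB, Matrix.of_apply]
    rw [Fintype.sum_prod_type, Finset.sum_comm]
  rw [h, hN.2]
  simp

lemma isClosed_posSemidef' {n : Type*} [Fintype n] :
    IsClosed {A : Matrix n n ℂ | A.PosSemidef} := by
  simp only [Matrix.posSemidef_iff_dotProduct_mulVec, Set.ofPred_and, Set.ofPred_forall]
  refine IsClosed.inter ?_ (isClosed_iInter fun x => ?_)
  · exact isClosed_eq continuous_id.matrix_conjTranspose continuous_id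
  · refine isClosed_le continuous_const ?_
    exact continuous_const.dotProduct (continuous_id.matrix_mulVec continuous_const)

lemma isCompact_feas {dB dR J : ℕ} (C : Fin J → Matrix (Fin dB × Fin dR) (Fin dB × Fin dR) ℂ)
    (q : Fin J → ℝ) : IsCompact (feas C q) := by
  have hcomp : IsCompact (Set.univ.pi fun _ : Fin dB × Fin dR => Set.univ.pi
      fun _ : Fin dB × Fin dR => Metric.closedBall (0 : ℂ) dR) :=
    isCompact_univ_pi fun _ => isCompact_univ_pi fun _ => isCompact_closedBall _ _
  refine IsCompact.of_isClosed_subset hcomp ?_ ?_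
  · have : feas C q = {N | N.PosSemidef} ∩ {N | ptraceB N = 1} ∩
        ⋂ j, {N | Matrix.trace (C j * N) = (q j : ℂ)} := by
      ext N; simp [feas, IsChoi]
    rw [this]
    refine (isClosed_posSemidef'.inter (isClosed_eq ?_ continuous_const)).inter
      (isClosed_iInter fun j => isClosed_eq ?_ continuous_const)
    · refine continuous_matrix fun i j => ?_
      simp only [ptraceB, Matrix.of_apply]
      exact continuous_finsetSum _ fun b _ => continuous_id.matrix_elem _ _
    · exact (continuous_const.matrix_mul continuous_id).matrix_trace
  · intro N hN i _ j _
    have h := norm_apply_le_trace hN.1.1 i j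
    rw [trace_of_choi hN.1] at h
    simpa using h

/-- Peierls type inequality with equality case. -/
lemma vnEnt_le_diag {n : Type*} [Fintype n] [DecidableEq n]
    {A : Matrix n n ℂ} (hA : A.PosSemidef) (U : Matrix.unitaryGroup n ℂ) :
    (∀ i, 0 ≤ ((star (U : Matrix n n ℂ) * A * U) i i).re) ∧
    vnEnt A ≤ ∑ i, Real.negMulLog ((star (U : Matrix n n ℂ) * A * U) i i).re ∧
    (vnEnt A = ∑ i, Real.negMulLog ((star (U : Matrix n n ℂ) * A * U) i i).re →
      A * U = U * Matrix.diagonal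
        (fun i => (((star (U : Matrix n n ℂ) * A * U) i i).re : ℂ))) := by
  set V := hA.1.eigenvectorUnitary
  set l := hA.1.eigenvalues
  have hspec : A = (V : Matrix n n ℂ) * Matrix.diagonal (fun i => (l i : ℂ)) *
      star (V : Matrix n n ℂ) := by
    have h1 : hermCFC id A = A := by rw [hermCFC_eq _ hA.1]; exact cfc_id ℝ A hA.1
    conv_lhs => rw [← h1, hermCFC, dif_pos hA.1]
    rfl
  set W : Matrix n n ℂ := star (V : Matrix n n ℂ) * U with hW
  have hWW : star W * W = 1 := by
    rw [hW, star_mul, star_star, Matrix.mul_assoc, ← Matrix.mul_assoc (V : Matrix n n ℂ),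
      unit_ms, Matrix.one_mul, Unitary.coe_star_mul_self]
  have hWW' : W * star W = 1 := mul_eq_one_comm.mp hWW
  have hconj : star (U : Matrix n n ℂ) * A * U =
      star W * Matrix.diagonal (fun i => (l i : ℂ)) * W := by
    conv_lhs => rw [hspec]
    rw [hW, star_mul, star_star]
    simp only [Matrix.mul_assoc]
  set w : n → n → ℝ := fun i k => Complex.normSq (W k i) with hw
  have hw0 : ∀ i k, 0 ≤ w i k := fun i k => Complex.normSq_nonneg _
  have hw1 : ∀ i, ∑ k, w i k = 1 := by
    intro i
    have := congrFun (congrFun hWW i) i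
    rw [Matrix.mul_apply] at this
    simp only [Matrix.star_apply, Matrix.one_apply_eq] at this
    have h2 : ((∑ k, w i k : ℝ) : ℂ) = 1 := by
      rw [← this]
      push_cast
      refine Finset.sum_congr rfl fun k _ => ?_
      rw [hw, Complex.normSq_eq_conj_mul_self]; rfl
    exact_mod_cast h2
  have hw2 : ∀ k, ∑ i, w i k = 1 := by
    intro k
    have := congrFun (congrFun hWW' k) k
    rw [Matrix.mul_apply] at this
    simp only [Matrix.star_apply, Matrix.one_apply_eq] at this
    have h2 : ((∑ i, w i k : ℝ) : ℂ) = 1 := by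
      rw [← this]
      push_cast
      refine Finset.sum_congr rfl fun i _ => ?_
      rw [hw, ← Complex.mul_conj]; rfl
    exact_mod_cast h2
  have ha : ∀ i, ((star (U : Matrix n n ℂ) * A * U) i i).re = ∑ k, w i k • l k := by
    intro i
    have h2 : (star (U : Matrix n n ℂ) * A * U) i i = ((∑ k, w i k • l k : ℝ) : ℂ) := by
      rw [hconj, Matrix.mul_apply]
      push_cast
      refine Finset.sum_congr rfl fun k _ => ?_
      rw [Matrix.mul_diagonal, Matrix.star_apply, smul_eq_mul, Complex.ofReal_mul, hw,
        Complex.normSq_eq_conj_mul_self]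
      change star (W k i) * _ * _ = star (W k i) * _ * _
      ring
    rw [h2, Complex.ofReal_re]
  have hl : ∀ k, 0 ≤ l k := hA.eigenvalues_nonneg
  have hmem : ∀ k ∈ (Finset.univ : Finset n), l k ∈ Set.Ici (0 : ℝ) := fun k _ => hl k
  have hent : vnEnt A = ∑ i, ∑ k, w i k • Real.negMulLog (l k) := by
    rw [vnEnt_eq_sum hA.1, Finset.sum_comm]
    refine Finset.sum_congr rfl fun k _ => ?_
    rw [← Finset.sum_smul, hw2, one_smul]
  have hJ : ∀ i, ∑ k, w i k • Real.negMulLog (l k) ≤ Real.negMulLog (∑ k, w i k • l k) :=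
    fun i => Real.concaveOn_negMulLog.le_map_sum (fun k _ => hw0 i k) (hw1 i) hmem
  simp only [ha]
  refine ⟨fun i => Finset.sum_nonneg fun k _ => smul_nonneg (hw0 i k) (hl k), ?_, ?_⟩
  · rw [hent]
    exact Finset.sum_le_sum fun i _ => hJ i
  · intro heq
    rw [hent, Finset.sum_eq_sum_iff_of_le fun i _ => hJ i] at heq
    have key : ∀ i k, W k i ≠ 0 → ∑ k', w i k' • l k' = l k := by
      intro i k hk
      have h3 := (Real.strictConcaveOn_negMulLog.map_sum_eq_iff_of_nonneg
        (fun k _ => hw0 i k) (hw1 i) hmem).mp (heq i (Finset.mem_univ _)).symm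
      have hk' : w i k ≠ 0 := by simpa [hw] using hk
      calc ∑ k', w i k' • l k' = ∑ k', w i k' • l k := by
            refine Finset.sum_congr rfl fun k' _ => ?_
            by_cases h0 : w i k' = 0
            · simp [h0]
            · rw [h3 (Finset.mem_univ k') h0 (Finset.mem_univ k) hk']
        _ = l k := by rw [← Finset.sum_smul, hw1, one_smul]
    have hD : Matrix.diagonal (fun i => (l i : ℂ)) * W =
        W * Matrix.diagonal (fun i => ((∑ k, w i k • l k : ℝ) : ℂ)) := by
      ext k i
      rw [Matrix.diagonal_mul, Matrix.mul_diagonal]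
      by_cases h0 : W k i = 0
      · simp [h0]
      · rw [key i k h0, mul_comm]
    have hVW : (V : Matrix n n ℂ) * W = U := by
      rw [hW, ← Matrix.mul_assoc, unit_ms, Matrix.one_mul]
    calc A * U = V * (Matrix.diagonal (fun i => (l i : ℂ)) * W) := by
          conv_lhs => rw [hspec]
          rw [hW]; simp only [Matrix.mul_assoc]
      _ = _ := by rw [hD, ← Matrix.mul_assoc, hVW]

lemma vnEnt_strict {n : Type*} [Fintype n] [DecidableEq n]
    {A B : Matrix n n ℂ} (hA : A.PosSemidef) (hB : B.PosSemidef) (hAB : A ≠ B) :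
    (vnEnt A + vnEnt B) / 2 < vnEnt ((1 / 2 : ℝ) • (A + B)) := by
  set M := (1 / 2 : ℝ) • (A + B) with hM
  have hMh : M.IsHermitian := by
    rw [hM, Matrix.IsHermitian, Matrix.conjTranspose_smul, (hA.1.add hB.1).eq]; simp
  set U := hMh.eigenvectorUnitary
  obtain ⟨ha0, ha1, ha2⟩ := vnEnt_le_diag hA U
  obtain ⟨hb0, hb1, hb2⟩ := vnEnt_le_diag hB U
  set a : n → ℝ := fun i => ((star (U : Matrix n n ℂ) * A * U) i i).re with ha
  set b : n → ℝ := fun i => ((star (U : Matrix n n ℂ) * B * U) i i).re with hb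
  have hm : ∀ i, hMh.eigenvalues i = (1 / 2 : ℝ) • a i + (1 / 2 : ℝ) • b i := by
    intro i
    have h1 : hermCFC id M = M := by rw [hermCFC_eq _ hMh]; exact cfc_id ℝ M hMh
    have h2 : star (U : Matrix n n ℂ) * M * U =
        Matrix.diagonal (fun i => (hMh.eigenvalues i : ℂ)) := by
      conv_lhs => rw [← h1, hermCFC, dif_pos hMh]
      change star (U : Matrix n n ℂ) * ((U : Matrix n n ℂ) * _ * star (U : Matrix n n ℂ)) * U = _
      rw [Matrix.mul_assoc (U : Matrix n n ℂ), ← Matrix.mul_assoc (star (U : Matrix n n ℂ)),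
        Unitary.coe_star_mul_self, Matrix.one_mul, Matrix.mul_assoc, Unitary.coe_star_mul_self,
        Matrix.mul_one]
      rfl
    have h3 := congrArg Complex.re (congrFun (congrFun h2 i) i)
    rw [Matrix.diagonal_apply_eq, Complex.ofReal_re] at h3
    rw [← h3, hM, Matrix.mul_smul, Matrix.smul_mul, Matrix.mul_add, Matrix.add_mul,
      Matrix.smul_apply, Matrix.add_apply, Complex.smul_re, Complex.add_re, smul_add]
  have hcc : ∀ i, (1 / 2 : ℝ) • Real.negMulLog (a i) + (1 / 2 : ℝ) • Real.negMulLog (b i) ≤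
      Real.negMulLog (hMh.eigenvalues i) := by
    intro i
    rw [hm]
    exact Real.concaveOn_negMulLog.2 (ha0 i) (hb0 i) (by norm_num) (by norm_num) (by norm_num)
  have hsum := Finset.sum_le_sum fun i (_ : i ∈ (Finset.univ : Finset n)) => hcc i
  rw [Finset.sum_add_distrib, ← Finset.smul_sum, ← Finset.smul_sum, ← vnEnt_eq_sum hMh] at hsum
  simp only [smul_eq_mul] at hsum
  change vnEnt A ≤ ∑ i, Real.negMulLog (a i) at ha1
  change vnEnt B ≤ ∑ i, Real.negMulLog (b i) at hb1
  by_contra hcon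
  push Not at hcon
  have hA' := ha2 (by change vnEnt A = ∑ i, Real.negMulLog (a i); linarith)
  have hB' := hb2 (by change vnEnt B = ∑ i, Real.negMulLog (b i); linarith)
  have hE : ∑ i, ((1 / 2 : ℝ) • Real.negMulLog (a i) + (1 / 2 : ℝ) • Real.negMulLog (b i)) =
      ∑ i, Real.negMulLog (hMh.eigenvalues i) := by
    rw [Finset.sum_add_distrib, ← Finset.smul_sum, ← Finset.smul_sum, ← vnEnt_eq_sum hMh]
    simp only [smul_eq_mul]
    linarith
  rw [Finset.sum_eq_sum_iff_of_le fun i _ => hcc i] at hE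
  have hab : a = b := by
    funext i
    by_contra hne
    have h1 := Real.strictConcaveOn_negMulLog.2 (ha0 i) (hb0 i) hne
      (by norm_num : (0 : ℝ) < 1 / 2) (by norm_num : (0 : ℝ) < 1 / 2) (by norm_num)
    have h2 := hE i (Finset.mem_univ i)
    rw [hm] at h2
    exact absurd h2 h1.ne
  apply hAB
  have hU : A * (U : Matrix n n ℂ) = B * U := by
    rw [hA', hB']
    congr 2
    funext i
    exact congrArg _ (congrFun hab i)
  calc A = A * U * star (U : Matrix n n ℂ) := by
        rw [Matrix.mul_assoc, unit_ms, Matrix.mul_one]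
    _ = B := by rw [hU, Matrix.mul_assoc, unit_ms, Matrix.mul_one]

lemma conj_injective {dB dR : ℕ} {φ : Matrix (Fin dR) (Fin dR) ℂ} (hφ : φ.PosDef)
    {N N' : Matrix (Fin dB × Fin dR) (Fin dB × Fin dR) ℂ}
    (h : ((1 : Matrix (Fin dB) (Fin dB) ℂ) ⊗ₖ matSqrt φ) * N *
      ((1 : Matrix (Fin dB) (Fin dB) ℂ) ⊗ₖ matSqrt φ) =
      ((1 : Matrix (Fin dB) (Fin dB) ℂ) ⊗ₖ matSqrt φ) * N' *
      ((1 : Matrix (Fin dB) (Fin dB) ℂ) ⊗ₖ matSqrt φ)) : N = N' := by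
  have hu : IsUnit (matSqrt φ) := by
    have h1 : IsUnit (matSqrt φ * matSqrt φ) := by
      rw [matSqrt_mul_self hφ.posSemidef]; exact hφ.isUnit
    exact ((Commute.refl (matSqrt φ)).isUnit_mul_iff.mp h1).1
  have hK : IsUnit ((1 : Matrix (Fin dB) (Fin dB) ℂ) ⊗ₖ matSqrt φ) := by
    obtain ⟨R, hR⟩ := hu.exists_right_inv
    refine IsUnit.of_mul_eq_one ((1 : Matrix (Fin dB) (Fin dB) ℂ) ⊗ₖ R) ?_
    rw [← Matrix.mul_kronecker_mul, hR, Matrix.one_mul, Matrix.one_kronecker_one]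
  exact hK.mul_left_cancel (hK.mul_right_cancel h)

lemma feas_unique {dB dR J : ℕ} (C : Fin J → Matrix (Fin dB × Fin dR) (Fin dB × Fin dR) ℂ)
    (q : Fin J → ℝ) {φ : Matrix (Fin dR) (Fin dR) ℂ} (hφ : φ.PosDef) {s : ℝ}
    (hs : ∀ N ∈ feas C q, condEnt φ N ≤ s)
    {N N' : Matrix (Fin dB × Fin dR) (Fin dB × Fin dR) ℂ}
    (hN : N ∈ feas C q) (hN' : N' ∈ feas C q) (h : condEnt φ N = s) (h' : condEnt φ N' = s) :
    N = N' := by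
  by_contra hne
  have hmid : (1 / 2 : ℝ) • (N + N') ∈ feas C q := by
    refine ⟨⟨(hN.1.1.add hN'.1.1).smul (by norm_num : (0 : ℝ) ≤ 1 / 2), ?_⟩, fun j => ?_⟩
    · have : ptraceB ((1 / 2 : ℝ) • (N + N')) = (1 / 2 : ℝ) • (ptraceB N + ptraceB N') := by
        ext i j
        simp [ptraceB, Finset.sum_add_distrib, Finset.mul_sum]
      rw [this, hN.1.2, hN'.1.2, ← two_smul ℝ (1 : Matrix (Fin dR) (Fin dR) ℂ), smul_smul]
      norm_num
    · rw [Matrix.mul_smul, Matrix.mul_add, Matrix.trace_smul, Matrix.trace_add, hN.2, hN'.2,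
        ← two_smul ℝ (q j : ℂ), smul_smul]
      norm_num
  have hlt := vnEnt_strict (conj_posSemidef φ hN.1.1) (conj_posSemidef φ hN'.1.1)
    fun he => hne (conj_injective hφ he)
  have hle := hs _ hmid
  unfold condEnt at h h' hle
  rw [Matrix.mul_smul, Matrix.smul_mul, Matrix.mul_add, Matrix.add_mul] at hle
  linarith

lemma stilde_eq {dB dR J : ℕ} (C : Fin J → Matrix (Fin dB × Fin dR) (Fin dB × Fin dR) ℂ)
    (q : Fin J → ℝ) (φ : Matrix (Fin dR) (Fin dR) ℂ) :
    stilde C q φ = sSup (condEnt φ '' feas C q) := by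
  unfold stilde
  congr 1
  ext x
  simp [feas, and_assoc]

section Berge

lemma berge_value {X Y : Type*} [TopologicalSpace X] [TopologicalSpace Y] [CompactSpace Y]
    [Nonempty Y] (f : X → Y → ℝ) (hf : Continuous (fun p : X × Y => f p.1 p.2)) (s : X → ℝ)
    (hs : ∀ x, s x = sSup (f x '' Set.univ)) :
    Continuous s ∧ (∀ x y, f x y ≤ s x) ∧ ∀ x, ∃ y, f x y = s x := by
  have hfx : ∀ x, Continuous (f x) := fun x => hf.comp (Continuous.prodMk_right x)
  obtain rfl : s = fun x => sSup (f x '' Set.univ) := funext hs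
  refine ⟨isCompact_univ.continuous_sSup hf, fun x y => ?_, fun x => ?_⟩
  · exact le_csSup (isCompact_univ.image (hfx x)).bddAbove ⟨y, trivial, rfl⟩
  · obtain ⟨y, _, hy⟩ := isCompact_univ.exists_sSup_image_eq Set.univ_nonempty (hfx x).continuousOn
    exact ⟨y, hy.symm⟩

lemma berge_arg {X Y : Type*} [TopologicalSpace X] [TopologicalSpace Y] [CompactSpace Y]
    (f : X → Y → ℝ) (hf : Continuous (fun p : X × Y => f p.1 p.2)) (s : X → ℝ)
    (hs : Continuous s) (T : X → Y) (hT : ∀ x, f x (T x) = s x)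
    (hu : ∀ x y, f x y = s x → y = T x) : Continuous T := by
  rw [continuous_iff_isClosed]
  intro F hF
  have hset : T ⁻¹' F = Prod.fst '' ({p : X × Y | f p.1 p.2 = s p.1} ∩ Prod.snd ⁻¹' F) := by
    ext x
    constructor
    · intro h
      exact ⟨(x, T x), ⟨hT x, h⟩, rfl⟩
    · rintro ⟨⟨x', y⟩, ⟨h1, h2⟩, rfl⟩
      have := hu x' y h1
      change T x' ∈ F
      rw [← this]
      exact h2
  rw [hset]
  exact isClosedMap_fst_of_compactSpace _
    ((isClosed_eq hf (hs.comp continuous_fst)).inter (hF.preimage continuous_snd))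

end Berge

lemma continuous_condEnt_sub {dB dR J : ℕ}
    (C : Fin J → Matrix (Fin dB × Fin dR) (Fin dB × Fin dR) ℂ) (q : Fin J → ℝ)
    (D : Set (Matrix (Fin dR) (Fin dR) ℂ)) (hD : ∀ φ ∈ D, IsDensity φ) :
    Continuous (fun p : D × feas C q => condEnt p.1.1 p.2.1) := by
  refine continuousOn_condEnt.comp_continuous
    (f := fun p : D × feas C q => ((p.1 : Matrix (Fin dR) (Fin dR) ℂ),
      (p.2 : Matrix (Fin dB × Fin dR) (Fin dB × Fin dR) ℂ))) ?_ ?_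
  · exact (continuous_subtype_val.comp continuous_fst).prodMk
      (continuous_subtype_val.comp continuous_snd)
  · exact fun p => ⟨(hD _ p.1.2).1.1, p.2.2.1.1.1⟩

lemma stilde_facts {dB dR J : ℕ}
    (C : Fin J → Matrix (Fin dB × Fin dR) (Fin dB × Fin dR) ℂ) (q : Fin J → ℝ)
    (hne : (feas C q).Nonempty) :
    ContinuousOn (stilde C q) {φ : Matrix (Fin dR) (Fin dR) ℂ | IsDensity φ} ∧
    (∀ φ, IsDensity φ → ∀ N ∈ feas C q, condEnt φ N ≤ stilde C q φ) ∧
    (∀ φ, IsDensity φ → ∃ N ∈ feas C q, condEnt φ N = stilde C q φ) := by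
  have hcs : CompactSpace (feas C q) := isCompact_iff_compactSpace.mp (isCompact_feas C q)
  have hnt : Nonempty (feas C q) := hne.to_subtype
  obtain ⟨h1, h2, h3⟩ := berge_value
    (fun (φ : {φ : Matrix (Fin dR) (Fin dR) ℂ | IsDensity φ}) (N : feas C q) => condEnt φ.1 N.1)
    (continuous_condEnt_sub C q _ fun φ h => h) (fun φ => stilde C q φ.1) (by
      intro φ
      rw [stilde_eq, Set.image_eq_range, Set.image_univ])
  refine ⟨continuousOn_iff_continuous_domRestrict.mpr h1, fun φ hφ N hN => h2 ⟨φ, hφ⟩ ⟨N, hN⟩,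
    fun φ hφ => ?_⟩
  obtain ⟨N, hN⟩ := h3 ⟨φ, hφ⟩
  exact ⟨N.1, N.2, hN⟩

lemma continuousOn_argmax {dB dR J : ℕ}
    (C : Fin J → Matrix (Fin dB × Fin dR) (Fin dB × Fin dR) ℂ) (q : Fin J → ℝ)
    (D : Set (Matrix (Fin dR) (Fin dR) ℂ)) (hD : ∀ φ ∈ D, IsDensity φ)
    (hs : ContinuousOn (stilde C q) D)
    (T : Matrix (Fin dR) (Fin dR) ℂ → Matrix (Fin dB × Fin dR) (Fin dB × Fin dR) ℂ)
    (hTf : ∀ φ ∈ D, T φ ∈ feas C q) (hT : ∀ φ ∈ D, condEnt φ (T φ) = stilde C q φ)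
    (hu : ∀ φ ∈ D, ∀ N ∈ feas C q, condEnt φ N = stilde C q φ → N = T φ) :
    ContinuousOn T D := by
  have hcs : CompactSpace (feas C q) := isCompact_iff_compactSpace.mp (isCompact_feas C q)
  have h := berge_arg (fun (φ : D) (N : feas C q) => condEnt φ.1 N.1)
    (continuous_condEnt_sub C q D hD) (fun φ => stilde C q φ.1)
    (continuousOn_iff_continuous_domRestrict.mp hs)
    (fun φ => ⟨T φ.1, hTf φ.1 φ.2⟩) (fun φ => hT φ.1 φ.2)
    (fun φ N hN => Subtype.ext (hu φ.1 φ.2 N.1 N.2 hN))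
  exact continuousOn_iff_continuous_domRestrict.mpr (continuous_subtype_val.comp h)

end Helpers

/-- **Stability of the thermal quantum channel in the input state `φ`.** -/
theorem thermal_channel_stability
    {dB dR J : ℕ} (hdB : 1 ≤ dB) (hdR : 1 ≤ dR)
    (C : Fin J → Matrix (Fin dB × Fin dR) (Fin dB × Fin dR) ℂ)
    (hC : ∀ j, (C j).IsHermitian) (q : Fin J → ℝ)
    (hstrict : ∃ N : Matrix (Fin dB × Fin dR) (Fin dB × Fin dR) ℂ,
      IsChoi N ∧ N.PosDef ∧ ∀ j, Matrix.trace (C j * N) = (q j : ℂ)) :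
    -- (i) `s̃` is continuous on the set of all density matrices
    ContinuousOn (stilde C q) {φ : Matrix (Fin dR) (Fin dR) ℂ | IsDensity φ}
    ∧
    -- (ii) for positive definite `φ` the optimizer is unique, and depends continuously on `φ`
    ∃ T : Matrix (Fin dR) (Fin dR) ℂ → Matrix (Fin dB × Fin dR) (Fin dB × Fin dR) ℂ,
      (∀ φ, IsDensity φ → φ.PosDef →
        (IsChoi (T φ) ∧ (∀ j, Matrix.trace (C j * T φ) = (q j : ℂ)) ∧
          condEnt φ (T φ) = stilde C q φ) ∧
        (∀ N : Matrix (Fin dB × Fin dR) (Fin dB × Fin dR) ℂ,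
          IsChoi N → (∀ j, Matrix.trace (C j * N) = (q j : ℂ)) →
            condEnt φ N = stilde C q φ → N = T φ)) ∧
      ContinuousOn T {φ : Matrix (Fin dR) (Fin dR) ℂ | IsDensity φ ∧ φ.PosDef} := by
  have hne : (feas C q).Nonempty := by
    obtain ⟨N, h1, _, h2⟩ := hstrict
    exact ⟨N, h1, h2⟩
  obtain ⟨hs, hle, hex⟩ := stilde_facts C q hne
  refine ⟨hs, ?_⟩
  have hex' : ∀ φ : Matrix (Fin dR) (Fin dR) ℂ,
      ∃ N : Matrix (Fin dB × Fin dR) (Fin dB × Fin dR) ℂ,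
        IsDensity φ → N ∈ feas C q ∧ condEnt φ N = stilde C q φ := by
    intro φ
    by_cases hφ : IsDensity φ
    · obtain ⟨N, hN⟩ := hex φ hφ
      exact ⟨N, fun _ => hN⟩
    · exact ⟨0, fun h => absurd h hφ⟩
  choose T hT using hex'
  have hu : ∀ φ, IsDensity φ → φ.PosDef → ∀ N ∈ feas C q,
      condEnt φ N = stilde C q φ → N = T φ := fun φ hφ hpd N hN h =>
    feas_unique C q hpd (hle φ hφ) hN (hT φ hφ).1 h (hT φ hφ).2
  refine ⟨T, fun φ hφ hpd => ⟨⟨(hT φ hφ).1.1, (hT φ hφ).1.2, (hT φ hφ).2⟩,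
    fun N h1 h2 h3 => hu φ hφ hpd N ⟨h1, h2⟩ h3⟩, ?_⟩
  exact continuousOn_argmax C q _ (fun φ h => h.1) (hs.mono fun φ h => h.1) T
    (fun φ h => (hT φ h.1).1) (fun φ h => (hT φ h.1).2) (fun φ h => hu φ h.1 h.2)

end ThermalPaper
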